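/- arXiv:1212.5424 — 5 statements merged into one kernel-verified Lean document; each statement's English description precedes it below -/
import Mathlib

section
/- Let R > 0, let U be the open disk of radius R centred at 0 in ℂ equipped with two-dimensional Lebesgue measure, and let A = {z ∈ ℂ : |z| > R}. For z ∈ A, the function x ↦ 1/(x − z) is bounded on U; let G(z) ∈ L²(U, ℂ) denote its equivalence class. Then G : A → L²(U, ℂ) is holomorphic, i.e. complex (Fréchet) differentiable at every point of A, and its derivative at z ∈ A is the equivalence class of x ↦ 1/(x − z)². -/
open MeasureTheory Metric Complex Filter

/-- Second-order Taylor remainder of `z ↦ (x - z)⁻¹`. -/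
lemma inv_sub_taylor_remainder {x z w : ℂ} (hz : x - z ≠ 0) (hw : x - w ≠ 0) :
    (x - w)⁻¹ - (x - z)⁻¹ - (w - z) * ((x - z) ^ 2)⁻¹
      = (w - z) ^ 2 * ((x - w)⁻¹ * ((x - z) ^ 2)⁻¹) := by
  field_simp
  ring

lemma norm_inv_sub_le {R d : ℝ} (hd : 0 < d) {x z : ℂ} (hx : x ∈ ball (0 : ℂ) R)
    (hz : R + d ≤ ‖z‖) : x - z ≠ 0 ∧ ‖(x - z)⁻¹‖ ≤ d⁻¹ := by
  rw [mem_ball_zero_iff] at hx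
  have h : d ≤ ‖x - z‖ := by
    have := norm_sub_norm_le z x
    rw [norm_sub_rev] at this
    linarith
  refine ⟨norm_pos_iff.mp (hd.trans_le h), ?_⟩
  rw [norm_inv]
  exact inv_anti₀ hd h

/-- Let U be the open disk of radius R at 0 in ℂ with Lebesgue measure and
A = {z : R < |z|}.  For z ∈ A the function x ↦ 1/(x−z) is bounded on U; let G(z) ∈ L²(U,ℂ)
denote its equivalence class and let G'(z) be the class of x ↦ 1/(x−z)².  Then G is
holomorphic on A (complex differentiable at every point), with derivative G'(z) at z. -/
theorem stmt6 (R : ℝ) (hR : 0 < R)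
    (G G' : ℂ → Lp ℂ 2 (volume.restrict (Metric.ball (0:ℂ) R)))
    (hG : ∀ z : ℂ, R < ‖z‖ →
      (G z : ℂ → ℂ) =ᵐ[volume.restrict (Metric.ball (0:ℂ) R)] fun x => (x - z)⁻¹)
    (hG' : ∀ z : ℂ, R < ‖z‖ →
      (G' z : ℂ → ℂ) =ᵐ[volume.restrict (Metric.ball (0:ℂ) R)] fun x => ((x - z) ^ 2)⁻¹) :
    ∀ z : ℂ, R < ‖z‖ →
      (∃ C : ℝ, ∀ x ∈ Metric.ball (0:ℂ) R, ‖(x - z)⁻¹‖ ≤ C) ∧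
      HasDerivAt G (G' z) z := by
  intro z hz
  obtain ⟨d, hd, hdz⟩ : ∃ d : ℝ, 0 < d ∧ R + 2 * d ≤ ‖z‖ :=
    ⟨(‖z‖ - R) / 2, by linarith, by linarith⟩
  have hz' : R + d ≤ ‖z‖ := by linarith
  refine ⟨⟨d⁻¹, fun x hx => (norm_inv_sub_le hd hx hz').2⟩, ?_⟩
  have : IsFiniteMeasure (volume.restrict (ball (0 : ℂ) R)) :=
    isFiniteMeasure_restrict.mpr measure_ball_lt_top.ne
  rw [hasDerivAt_iff_isLittleO]
  refine Asymptotics.IsBigO.trans_isLittleO (g := fun w => ‖w - z‖ ^ 2) ?_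
    (Asymptotics.isLittleO_pow_sub_sub z one_lt_two)
  refine Asymptotics.IsBigO.of_bound
    ((measureUnivNNReal (volume.restrict (ball (0 : ℂ) R)) : ℝ) ^ (2 : ENNReal).toReal⁻¹
      * (d⁻¹ * d⁻¹ ^ 2)) ?_
  filter_upwards [ball_mem_nhds z hd] with w hw
  have hw' : R + d ≤ ‖w‖ := by
    have := norm_sub_norm_le z w
    rw [mem_ball_iff_norm'] at hw
    linarith
  rw [norm_pow, norm_norm, ← norm_pow, mul_assoc, mul_comm (d⁻¹ * d⁻¹ ^ 2)]
  refine Lp.norm_le_of_ae_bound (by positivity) ?_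
  filter_upwards [hG w (by linarith), hG z hz, hG' z hz,
    Lp.coeFn_sub (G w - G z) ((w - z) • G' z), Lp.coeFn_sub (G w) (G z),
    Lp.coeFn_smul (w - z) (G' z), ae_restrict_mem measurableSet_ball]
    with x hGw hGz hGz' h₁ h₂ h₃ hx
  obtain ⟨hxz, hbz⟩ := norm_inv_sub_le hd hx hz'
  obtain ⟨hxw, hbw⟩ := norm_inv_sub_le hd hx hw'
  rw [h₁, Pi.sub_apply, h₂, h₃, Pi.sub_apply, Pi.smul_apply, hGw, hGz, hGz', smul_eq_mul,
    inv_sub_taylor_remainder hxz hxw, norm_mul, norm_mul, ← inv_pow, norm_pow (x - z)⁻¹]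
  gcongr
end

section
/- Let 0 < R < 1, let V = {θ ∈ ℂ : |Im θ| < −(1/2) log R}, and let U be the open disk of radius R centred at 0 in ℂ with two-dimensional Lebesgue measure. For θ ∈ V let G(θ) ∈ L²(U, ℂ²) be the equivalence class of x ↦ ( 1/(x − e^{iθ}) , 1/(conj(x) − e^{−iθ}) ), which is well defined since |x − e^{iθ}| and |conj(x) − e^{−iθ}| exceed √R − R for |x| ≤ R and θ ∈ V. Then for every continuous ℂ-bilinear map Q : L²(U,ℂ²) × L²(U,ℂ²) → ℂ, the function ω̃(θ₁,θ₂,θ₃,θ₄) = Q( G(θ₁) − G(θ₂), G(θ₃) − G(θ₄) ) is holomorphic (complex Fréchet differentiable) on the open set V⁴ ⊆ ℂ⁴. -/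
open MeasureTheory Metric Complex Filter

/-- The horizontal strip V = {θ ∈ ℂ : |Im θ| < −(1/2) log R}. -/
def stripV (R : ℝ) : Set ℂ := {θ : ℂ | |θ.im| < -(1 / 2) * Real.log R}

open scoped BoundedContinuousFunction

/-- The radial retraction of the plane onto the closed disk of radius `R`, as a bounded continuous
function. -/
noncomputable def diskRetraction (R : ℝ) (hR : 0 < R) : ℂ →ᵇ ℂ :=
  BoundedContinuousFunction.ofNormedAddCommGroup
    (fun x : ℂ => ((R / max R ‖x‖ : ℝ) : ℂ) * x)
    (by
      have h : ∀ x : ℂ, max R ‖x‖ ≠ 0 := fun x => (lt_max_of_lt_left hR).ne'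
      fun_prop (disch := exact h _))
    R
    (by
      intro x
      have h : 0 < max R ‖x‖ := lt_max_of_lt_left hR
      rw [norm_mul, Complex.norm_real, Real.norm_of_nonneg (by positivity), div_mul_eq_mul_div,
        div_le_iff₀ h]
      exact mul_le_mul_of_nonneg_left (le_max_right _ _) hR.le)

lemma norm_diskRetraction_le (R : ℝ) (hR : 0 < R) : ‖diskRetraction R hR‖ ≤ R :=
  BoundedContinuousFunction.norm_ofNormedAddCommGroup_le _ hR.le _

lemma diskRetraction_apply_of_mem_ball {R : ℝ} (hR : 0 < R) {x : ℂ} (hx : x ∈ ball (0 : ℂ) R) :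
    diskRetraction R hR x = x := by
  have h : ‖x‖ ≤ R := (mem_ball_zero_iff.mp hx).le
  simp [diskRetraction, max_eq_left h, hR.ne']

lemma BoundedContinuousFunction.isUnit_sub_algebraMap {X : Type*} [TopologicalSpace X]
    [Nonempty X] {f : X →ᵇ ℂ} {c : ℂ} (hc : ‖f‖ < ‖c‖) : IsUnit (f - algebraMap ℂ (X →ᵇ ℂ) c) := by
  have h : c ∉ spectrum ℂ f := fun h => (spectrum.norm_le_norm_of_mem h).not_gt hc
  rw [← IsUnit.neg_iff, neg_sub]
  exact spectrum.notMem_iff.mp h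

lemma BoundedContinuousFunction.ringInverse_apply {X : Type*} [TopologicalSpace X]
    {f : X →ᵇ ℂ} (hf : IsUnit f) (x : X) : Ring.inverse f x = (f x)⁻¹ := by
  have h : (f * Ring.inverse f) x = 1 := by rw [Ring.mul_inverse_cancel f hf]; rfl
  exact eq_inv_of_mul_eq_one_right h

lemma lt_norm_exp_of_mem_stripV {R : ℝ} (hR0 : 0 < R) (hR1 : R < 1) {θ : ℂ}
    (hθ : θ ∈ stripV R) :
    R < ‖exp (I * θ)‖ ∧ R < ‖exp (-(I * θ))‖ := by
  have hlog := Real.log_neg hR0 hR1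
  have h := abs_lt.mp (show |θ.im| < -(1 / 2) * Real.log R from hθ)
  constructor <;> rw [Complex.norm_exp, ← Real.log_lt_iff_lt_exp hR0] <;> simp <;> linarith

/-- The pairing of two scalar bounded continuous functions as an `L²` function with values in
`ℂ × ℂ`. -/
noncomputable def pairToLp (μ : Measure ℂ) [IsFiniteMeasure μ] :
    (ℂ →ᵇ ℂ) × (ℂ →ᵇ ℂ) →L[ℂ] Lp (ℂ × ℂ) 2 μ :=
  (((ContinuousLinearMap.inl ℂ ℂ ℂ).compLpL 2 μ).comp
    (BoundedContinuousFunction.toLp 2 μ ℂ)).coprod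
  (((ContinuousLinearMap.inr ℂ ℂ ℂ).compLpL 2 μ).comp
    (BoundedContinuousFunction.toLp 2 μ ℂ))

lemma coeFn_pairToLp (μ : Measure ℂ) [IsFiniteMeasure μ] (f g : ℂ →ᵇ ℂ) :
    pairToLp μ (f, g) =ᵐ[μ] fun x => (f x, g x) := by
  have hf := BoundedContinuousFunction.coeFn_toLp (p := 2) μ ℂ f
  have hg := BoundedContinuousFunction.coeFn_toLp (p := 2) μ ℂ g
  have hl := ContinuousLinearMap.coeFn_compLpL (p := 2) (μ := μ) (ContinuousLinearMap.inl ℂ ℂ ℂ)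
    (BoundedContinuousFunction.toLp 2 μ ℂ f)
  have hr := ContinuousLinearMap.coeFn_compLpL (p := 2) (μ := μ) (ContinuousLinearMap.inr ℂ ℂ ℂ)
    (BoundedContinuousFunction.toLp 2 μ ℂ g)
  have hadd := Lp.coeFn_add
    ((ContinuousLinearMap.inl ℂ ℂ ℂ).compLpL 2 μ (BoundedContinuousFunction.toLp 2 μ ℂ f))
    ((ContinuousLinearMap.inr ℂ ℂ ℂ).compLpL 2 μ (BoundedContinuousFunction.toLp 2 μ ℂ g))
  filter_upwards [hf, hg, hl, hr, hadd] with x hf hg hl hr hadd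
  refine hadd.trans ?_
  rw [Pi.add_apply, hl, hr, hf, hg]
  simp

lemma differentiableOn_ringInverse_sub_algebraMap {R : ℝ} {s : Set ℂ} {f : ℂ →ᵇ ℂ} {c : ℂ → ℂ}
    (hf : ‖f‖ ≤ R) (hc : Differentiable ℂ c) (hs : ∀ θ ∈ s, R < ‖c θ‖) :
    DifferentiableOn ℂ (fun θ => Ring.inverse (f - algebraMap ℂ (ℂ →ᵇ ℂ) (c θ))) s := by
  intro θ hθ
  have hu := BoundedContinuousFunction.isUnit_sub_algebraMap (hf.trans_lt (hs θ hθ))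
  have hd : DifferentiableAt ℂ (fun θ => f - algebraMap ℂ (ℂ →ᵇ ℂ) (c θ)) θ :=
    ((algebraMapCLM ℂ (ℂ →ᵇ ℂ)).differentiableAt.comp θ (hc θ)).const_sub f
  exact (((differentiableAt_inverse (𝕜 := ℂ) hu)).comp θ hd).differentiableWithinAt

lemma differentiableOn_of_coeFn_eq {R : ℝ} (hR0 : 0 < R) (hR1 : R < 1)
    {G : ℂ → Lp (ℂ × ℂ) 2 (volume.restrict (ball (0:ℂ) R))}
    (hG : ∀ θ ∈ stripV R,
      (G θ : ℂ → ℂ × ℂ) =ᵐ[volume.restrict (ball (0:ℂ) R)]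
        fun x => ((x - exp (I * θ))⁻¹, ((starRingEnd ℂ) x - exp (-(I * θ)))⁻¹)) :
    DifferentiableOn ℂ G (stripV R) := by
  have : IsFiniteMeasure (volume.restrict (ball (0:ℂ) R)) :=
    ⟨by simpa using measure_ball_lt_top (μ := (volume : Measure ℂ)) (x := 0) (r := R)⟩
  set f := diskRetraction R hR0 with hfdef
  have hf : ‖f‖ ≤ R := norm_diskRetraction_le R hR0
  have hf' : ‖star f‖ ≤ R := by rwa [norm_star]
  have hd := (differentiableOn_ringInverse_sub_algebraMap (s := stripV R)
    (c := fun θ => exp (I * θ)) hf (by fun_prop)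
    fun θ hθ => (lt_norm_exp_of_mem_stripV hR0 hR1 hθ).1).prodMk
    (differentiableOn_ringInverse_sub_algebraMap (s := stripV R)
    (c := fun θ => exp (-(I * θ))) hf' (by fun_prop)
    fun θ hθ => (lt_norm_exp_of_mem_stripV hR0 hR1 hθ).2)
  refine ((pairToLp (volume.restrict (ball (0:ℂ) R))).differentiable.comp_differentiableOn
    hd).congr fun θ hθ => ?_
  obtain ⟨h₁, h₂⟩ := lt_norm_exp_of_mem_stripV hR0 hR1 hθ
  apply Lp.ext
  filter_upwards [hG θ hθ, coeFn_pairToLp (volume.restrict (ball (0:ℂ) R)) _ _,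
    ae_restrict_mem measurableSet_ball] with x hx hp hmem
  refine hx.trans (Eq.trans ?_ hp.symm)
  rw [BoundedContinuousFunction.ringInverse_apply
      (BoundedContinuousFunction.isUnit_sub_algebraMap (hf.trans_lt h₁)),
    BoundedContinuousFunction.ringInverse_apply
      (BoundedContinuousFunction.isUnit_sub_algebraMap (hf'.trans_lt h₂))]
  simp [hfdef, diskRetraction_apply_of_mem_ball hR0 hmem,
    BoundedContinuousFunction.algebraMap_apply]

/-- Let 0 < R < 1, V = {θ : |Im θ| < −(1/2) log R}, and U the open disk of radius R with
Lebesgue measure.  For θ ∈ V let G(θ) ∈ L²(U,ℂ²) be the class of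
x ↦ ( 1/(x − e^{iθ}) , 1/(conj x − e^{−iθ}) ).  Then for every continuous ℂ-bilinear map
Q : L²(U,ℂ²) × L²(U,ℂ²) → ℂ, the four-electrode function
ω̃(θ₁,θ₂,θ₃,θ₄) = Q( G(θ₁) − G(θ₂), G(θ₃) − G(θ₄) ) is holomorphic on V⁴ ⊆ ℂ⁴. -/
theorem stmt7 (R : ℝ) (hR0 : 0 < R) (hR1 : R < 1)
    (G : ℂ → Lp (ℂ × ℂ) 2 (volume.restrict (Metric.ball (0:ℂ) R)))
    (hG : ∀ θ ∈ stripV R,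
      (G θ : ℂ → ℂ × ℂ) =ᵐ[volume.restrict (Metric.ball (0:ℂ) R)]
        fun x => ((x - Complex.exp (Complex.I * θ))⁻¹,
                  ((starRingEnd ℂ) x - Complex.exp (-(Complex.I * θ)))⁻¹)) :
    ∀ Q : Lp (ℂ × ℂ) 2 (volume.restrict (Metric.ball (0:ℂ) R)) →L[ℂ]
          Lp (ℂ × ℂ) 2 (volume.restrict (Metric.ball (0:ℂ) R)) →L[ℂ] ℂ,
      DifferentiableOn ℂ
        (fun p : ℂ × ℂ × ℂ × ℂ => Q (G p.1 - G p.2.1) (G p.2.2.1 - G p.2.2.2))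
        (stripV R ×ˢ stripV R ×ˢ stripV R ×ˢ stripV R) := by
  intro Q
  have hd := differentiableOn_of_coeFn_eq hR0 hR1 hG
  have h₁ := hd.comp (s := stripV R ×ˢ stripV R ×ˢ stripV R ×ˢ stripV R)
    (f := fun p : ℂ × ℂ × ℂ × ℂ => p.1) (by fun_prop) fun p hp => hp.1
  have h₂ := hd.comp (s := stripV R ×ˢ stripV R ×ˢ stripV R ×ˢ stripV R)
    (f := fun p : ℂ × ℂ × ℂ × ℂ => p.2.1) (by fun_prop) fun p hp => hp.2.1
  have h₃ := hd.comp (s := stripV R ×ˢ stripV R ×ˢ stripV R ×ˢ stripV R)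
    (f := fun p : ℂ × ℂ × ℂ × ℂ => p.2.2.1) (by fun_prop) fun p hp => hp.2.2.1
  have h₄ := hd.comp (s := stripV R ×ˢ stripV R ×ˢ stripV R ×ˢ stripV R)
    (f := fun p : ℂ × ℂ × ℂ × ℂ => p.2.2.2) (by fun_prop) fun p hp => hp.2.2.2
  exact (Q.differentiable.comp_differentiableOn (h₁.sub h₂)).clm_apply (h₃.sub h₄)
end

section
/- Let D ⊂ ℝ² be a bounded open set, σ : D → ℝ bounded and measurable, and μ a finite signed Borel measure on the topological boundary ∂D. Let u : D → ℝ be differentiable with |∇u| Lebesgue integrable on D, and suppose that ∫_D σ ∇u·∇φ dx = ∫_{∂D} φ dμ holds for every φ : ℝ² → ℝ of class C^∞. Then the same identity ∫_D σ ∇u·∇φ dx = ∫_{∂D} φ dμ holds for every Lipschitz function φ : ℝ² → ℝ, where ∇φ denotes the almost-everywhere defined gradient of φ (Rademacher's theorem). -/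
open MeasureTheory Metric Complex Filter

/-- Integral of a function against a finite signed Borel measure, via the Jordan
decomposition. -/
noncomputable def sIntegral {α : Type*} [MeasurableSpace α] (μ : SignedMeasure α)
    {E : Type*} [NormedAddCommGroup E] [NormedSpace ℝ E] (f : α → E) : E :=
  (∫ x, f x ∂μ.toJordanDecomposition.posPart) - ∫ x, f x ∂μ.toJordanDecomposition.negPart

/-- The gradient of `u : ℂ → ℝ` as an element of ℂ ≅ ℝ². -/
noncomputable def grad (u : ℂ → ℝ) (x : ℂ) : ℂ :=
  (fderiv ℝ u x 1 : ℝ) + (fderiv ℝ u x Complex.I : ℝ) * Complex.I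

/-- The euclidean dot product on ℂ ≅ ℝ². -/
def dot (a b : ℂ) : ℝ := a.re * b.re + a.im * b.im

open scoped Topology Convolution

section Mollification

variable {E : Type*} [NormedAddCommGroup E] [NormedSpace ℝ E] [FiniteDimensional ℝ E]
  [MeasurableSpace E] [BorelSpace E] {ν : Measure E} [ν.IsAddHaarMeasure]
  {f : E → ℝ} {K : NNReal}

/-- The derivative of a mollified Lipschitz function is the mollification of its almost everywhere
defined derivative. -/
theorem LipschitzWith.hasFDerivAt_normed_convolution (hf : LipschitzWith K f)
    (η : ContDiffBump (0 : E)) (x : E) :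
    HasFDerivAt (η.normed ν ⋆[ContinuousLinearMap.lsmul ℝ ℝ, ν] f)
      ((η.normed ν ⋆[ContinuousLinearMap.lsmul ℝ ℝ, ν] fderiv ℝ f) x) x := by
  have hF (y : E) : Continuous fun t => η.normed ν t • f (y - t) :=
    η.continuous_normed.smul (hf.continuous.comp (continuous_const.sub continuous_id))
  have hmeas : Measurable fun t => fderiv ℝ f (x - t) :=
    (measurable_fderiv ℝ f).comp (measurable_const.sub measurable_id)
  refine (hasFDerivAt_integral_of_dominated_loc_of_lip (s := Set.univ)
    (F := fun y t => η.normed ν t • f (y - t))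
    (F' := fun t => η.normed ν t • fderiv ℝ f (x - t))
    (bound := fun t => η.normed ν t * K) univ_mem
    (.of_forall fun y => (hF y).aestronglyMeasurable) ?_ ?_ ?_
    (η.integrable_normed.mul_const _) ?_).2
  · exact (hF x).integrable_of_hasCompactSupport η.hasCompactSupport_normed.smul_right
  · exact (η.continuous_normed.measurable.smul hmeas).aestronglyMeasurable
  · refine .of_forall fun t => LipschitzOnWith.of_dist_le_mul fun y _ z _ => ?_
    have h := hf.dist_le_mul (y - t) (z - t)
    rw [dist_sub_right] at h
    have hnn := η.nonneg_normed (μ := ν) t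
    rw [dist_smul₀, Real.coe_nnabs, abs_of_nonneg (by positivity), Real.norm_of_nonneg hnn,
      mul_assoc]
    gcongr
  · have hqmp := quasiMeasurePreserving_sub_left ν x
    filter_upwards [hqmp.ae (hf.ae_differentiableAt (μ := ν))] with t ht
    have hcomp : HasFDerivAt (fun y => f (y - t)) (fderiv ℝ f (x - t)) x :=
      ht.hasFDerivAt.comp x ((hasFDerivAt_id x).sub_const t)
    exact hcomp.const_smul (η.normed ν t)

theorem LipschitzWith.norm_fderiv_normed_convolution_le (hf : LipschitzWith K f)
    (η : ContDiffBump (0 : E)) (x : E) :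
    ‖fderiv ℝ (η.normed ν ⋆[ContinuousLinearMap.lsmul ℝ ℝ, ν] f) x‖ ≤ K := by
  rw [(hf.hasFDerivAt_normed_convolution η x).fderiv]
  refine (norm_integral_le_of_norm_le (η.integrable_normed.mul_const (K : ℝ))
    (.of_forall fun t => ?_)).trans_eq ?_
  · have hnn := η.nonneg_normed (μ := ν) t
    rw [ContinuousLinearMap.lsmul_apply, norm_smul, Real.norm_of_nonneg hnn]
    gcongr
    exact norm_fderiv_le_of_lipschitz ℝ hf
  · rw [integral_mul_const, η.integral_normed, one_mul]

theorem LipschitzWith.locallyIntegrable_fderiv (hf : LipschitzWith K f) :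
    LocallyIntegrable (fderiv ℝ f) ν :=
  (locallyIntegrable_const (K : ℝ)).mono (measurable_fderiv ℝ f).aestronglyMeasurable
    (.of_forall fun _ => (norm_fderiv_le_of_lipschitz ℝ hf).trans (le_abs_self _))

/-- A Lipschitz function is a uniform limit of smooth functions with the same bound on the
derivative, whose derivatives converge almost everywhere. -/
theorem LipschitzWith.exists_contDiff_approx (ν : Measure E) [ν.IsAddHaarMeasure]
    (hf : LipschitzWith K f) :
    ∃ g : ℕ → E → ℝ, (∀ n, ContDiff ℝ (⊤ : ℕ∞) (g n)) ∧
      (∀ n x, |g n x - f x| ≤ K) ∧ (∀ x, Tendsto (fun n => g n x) atTop (𝓝 (f x))) ∧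
      (∀ n x, ‖fderiv ℝ (g n) x‖ ≤ K) ∧
      ∀ᵐ x ∂ν, Tendsto (fun n => fderiv ℝ (g n) x) atTop (𝓝 (fderiv ℝ f x)) := by
  have hpos (n : ℕ) : 0 < 1 / ((n : ℝ) + 1) := Nat.one_div_pos_of_nat
  let η (n : ℕ) : ContDiffBump (0 : E) :=
    ⟨1 / ((n : ℝ) + 1) / 2, 1 / ((n : ℝ) + 1), half_pos (hpos n), half_lt_self (hpos n)⟩
  have hη : Tendsto (fun n => (η n).rOut) atTop (𝓝 0) := tendsto_one_div_add_atTop_nhds_zero_nat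
  refine ⟨fun n => (η n).normed ν ⋆[ContinuousLinearMap.lsmul ℝ ℝ, ν] f, fun n => ?_,
    fun n x => ?_, ContDiffBump.convolution_tendsto_right_of_continuous hη hf.continuous,
    fun n => hf.norm_fderiv_normed_convolution_le (η n), ?_⟩
  · exact (η n).hasCompactSupport_normed.contDiff_convolution_left _ (η n).contDiff_normed
      hf.continuous.locallyIntegrable
  · rw [← Real.dist_eq]
    refine (η n).dist_normed_convolution_le hf.continuous.aestronglyMeasurable fun y hy => ?_
    have hr : (η n).rOut ≤ 1 := by
      have h := Nat.one_div_le_one_div (α := ℝ) (Nat.zero_le n)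
      rwa [Nat.cast_zero, zero_add, div_one] at h
    calc dist (f y) (f x) ≤ K * dist y x := hf.dist_le_mul y x
      _ ≤ K * 1 := by
        gcongr
        exact (mem_ball.1 hy).le.trans hr
      _ = K := mul_one _
  · filter_upwards [ContDiffBump.ae_convolution_tendsto_right_of_locallyIntegrable (K := 2) hη
      (.of_forall fun n => (mul_div_cancel₀ (1 / ((n : ℝ) + 1)) two_ne_zero).ge)
      (hf.locallyIntegrable_fderiv (ν := ν))] with x hx
    simpa only [(hf.hasFDerivAt_normed_convolution _ x).fderiv] using hx

end Mollification

theorem measurable_grad (u : ℂ → ℝ) : Measurable (grad u) := by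
  have h (v : ℂ) : Measurable fun x => fderiv ℝ u x v := measurable_fderiv_apply_const ℝ u v
  unfold grad
  exact (measurable_ofReal.comp (h 1)).add ((measurable_ofReal.comp (h I)).mul_const I)

theorem norm_grad_le (u : ℂ → ℝ) (x : ℂ) : ‖grad u x‖ ≤ 2 * ‖fderiv ℝ u x‖ := by
  have h1 := (fderiv ℝ u x).le_opNorm 1
  have hI := (fderiv ℝ u x).le_opNorm I
  rw [norm_one, mul_one] at h1
  rw [norm_I, mul_one] at hI
  calc ‖grad u x‖ ≤ ‖fderiv ℝ u x 1‖ + ‖fderiv ℝ u x I‖ :=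
        (norm_add_le _ _).trans_eq (by rw [norm_mul, norm_I, mul_one, norm_real, norm_real])
    _ ≤ 2 * ‖fderiv ℝ u x‖ := by linarith

theorem dot_eq_inner (a b : ℂ) : dot a b = inner ℝ a b := by
  simp [dot, Complex.inner, mul_comm]

theorem tendsto_grad {ι : Type*} {l : Filter ι} {g : ι → ℂ → ℝ} {f : ℂ → ℝ} {x : ℂ}
    (h : Tendsto (fun n => fderiv ℝ (g n) x) l (𝓝 (fderiv ℝ f x))) :
    Tendsto (fun n => grad (g n) x) l (𝓝 (grad f x)) := by
  have hv (v : ℂ) : Tendsto (fun n => fderiv ℝ (g n) x v) l (𝓝 (fderiv ℝ f x v)) :=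
    ((ContinuousLinearMap.apply ℝ ℝ v).continuous.tendsto _).comp h
  exact ((continuous_ofReal.tendsto _).comp (hv 1)).add
    (((continuous_ofReal.tendsto _).comp (hv I)).mul_const I)

theorem tendsto_setIntegral_dot_grad {D : Set ℂ} (hD : MeasurableSet D) {σ : ℂ → ℝ}
    (hσm : Measurable σ) {M : ℝ} (hσ : ∀ x ∈ D, |σ x| ≤ M) {u : ℂ → ℝ}
    (hu : IntegrableOn (fun x => ‖grad u x‖) D volume) {g : ℕ → ℂ → ℝ} {f : ℂ → ℝ} {C : ℝ}
    (hg : ∀ n x, ‖fderiv ℝ (g n) x‖ ≤ C)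
    (hlim : ∀ᵐ x, Tendsto (fun n => fderiv ℝ (g n) x) atTop (𝓝 (fderiv ℝ f x))) :
    Tendsto (fun n => ∫ x in D, σ x * dot (grad u x) (grad (g n) x)) atTop
      (𝓝 (∫ x in D, σ x * dot (grad u x) (grad f x))) := by
  simp only [dot_eq_inner]
  refine tendsto_integral_of_dominated_convergence (fun x => M * (‖grad u x‖ * (2 * C)))
    (fun n => ?_) ((hu.mul_const _).const_mul M) (fun n => ?_) ?_
  · exact (hσm.mul ((measurable_grad u).inner (measurable_grad (g n)))).aestronglyMeasurable
  · filter_upwards [ae_restrict_mem hD] with x hx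
    have hM := (abs_nonneg _).trans (hσ x hx)
    rw [norm_mul]
    gcongr
    · exact hσ x hx
    · refine (norm_inner_le_norm _ _).trans ?_
      gcongr
      exact (norm_grad_le _ _).trans (mul_le_mul_of_nonneg_left (hg n x) zero_le_two)
  · filter_upwards [ae_restrict_of_ae hlim] with x hx
    exact (tendsto_const_nhds.inner (tendsto_grad hx)).const_mul _

theorem tendsto_integral_of_isCompact_of_abs_sub_le {X : Type*} [TopologicalSpace X]
    [MeasurableSpace X] [OpensMeasurableSpace X] {ν : Measure X} [IsFiniteMeasure ν] {s : Set X}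
    (hs : IsCompact s) (hν : ν sᶜ = 0) {g : ℕ → X → ℝ} {f : X → ℝ} (hf : Continuous f)
    (hg : ∀ n, Continuous (g n)) {C : ℝ} (hC : ∀ n x, |g n x - f x| ≤ C)
    (hlim : ∀ x, Tendsto (fun n => g n x) atTop (𝓝 (f x))) :
    Tendsto (fun n => ∫ x, g n x ∂ν) atTop (𝓝 (∫ x, f x ∂ν)) := by
  obtain ⟨B, hB⟩ := hs.exists_bound_of_continuousOn hf.continuousOn
  refine tendsto_integral_of_dominated_convergence (fun _ => C + B)
    (fun n => (hg n).aestronglyMeasurable) (integrable_const _) (fun n => ?_) (.of_forall hlim)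
  filter_upwards [mem_ae_iff.2 hν] with x hx
  calc ‖g n x‖ = ‖(g n x - f x) + f x‖ := by rw [sub_add_cancel]
    _ ≤ ‖g n x - f x‖ + ‖f x‖ := norm_add_le _ _
    _ ≤ C + B := add_le_add (hC n x) (hB x hx)

/-- Let D ⊂ ℝ² ≅ ℂ be bounded open, σ bounded measurable on D, and μ a finite signed Borel
measure supported on ∂D.  If u is differentiable on D with |∇u| ∈ L¹(D) and
∫_D σ ∇u·∇φ dx = ∫_{∂D} φ dμ for every C^∞ function φ : ℝ² → ℝ, then the same identity
holds for every Lipschitz φ : ℝ² → ℝ (whose gradient is defined almost everywhere by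
Rademacher's theorem). -/
theorem stmt9 (D : Set ℂ) (hDopen : IsOpen D) (hDbdd : Bornology.IsBounded D)
    (σ : ℂ → ℝ) (hσm : Measurable σ) (hσb : ∃ M : ℝ, ∀ x ∈ D, |σ x| ≤ M)
    (μ : SignedMeasure ℂ) (hsupp : μ.totalVariation (frontier D)ᶜ = 0)
    (u : ℂ → ℝ) (hu : ∀ x ∈ D, DifferentiableAt ℝ u x)
    (hu1 : IntegrableOn (fun x => ‖grad u x‖) D volume)
    (hweak : ∀ φ : ℂ → ℝ, ContDiff ℝ (⊤ : ℕ∞) φ →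
      ∫ x in D, σ x * dot (grad u x) (grad φ x) = sIntegral μ φ) :
    ∀ φ : ℂ → ℝ, (∃ K : NNReal, LipschitzWith K φ) →
      ∫ x in D, σ x * dot (grad u x) (grad φ x) = sIntegral μ φ := by
  rintro φ ⟨K, hφ⟩
  obtain ⟨M, hM⟩ := hσb
  obtain ⟨g, hg, hgφ, hglim, hgK, hgrad⟩ := hφ.exists_contDiff_approx volume
  have hcpt : IsCompact (frontier D) :=
    hDbdd.isCompact_closure.of_isClosed_subset isClosed_frontier frontier_subset_closure
  rw [SignedMeasure.totalVariation, Measure.add_apply, add_eq_zero] at hsupp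
  refine tendsto_nhds_unique
    (tendsto_setIntegral_dot_grad hDopen.measurableSet hσm hM hu1 hgK hgrad) ?_
  simp only [fun n => hweak (g n) (hg n)]
  exact (tendsto_integral_of_isCompact_of_abs_sub_le hcpt hsupp.1 hφ.continuous
      (fun n => (hg n).continuous) hgφ hglim).sub
    (tendsto_integral_of_isCompact_of_abs_sub_le hcpt hsupp.2 hφ.continuous
      (fun n => (hg n).continuous) hgφ hglim)
end

section
/- Let D, E ⊂ ℂ be bounded open sets and Φ : D → E a holomorphic bijection with Φ'(z) ≠ 0 for every z ∈ D, which extends to a homeomorphism Φ̄ : cl(D) → cl(E) that is Lipschitz continuous on cl(D). Let σ : D → ℝ be bounded and measurable, μ a finite signed Borel measure on ∂D, and u : D → ℝ differentiable with |∇u| integrable on D, such that ∫_D σ ∇u·∇φ dx = ∫_{∂D} φ dμ for every Lipschitz φ : ℝ² → ℝ. Then ũ = u ∘ Φ⁻¹ : E → ℝ is differentiable with |∇ũ| integrable on E, and for every Lipschitz φ̃ : ℝ² → ℝ one has ∫_E (σ∘Φ⁻¹) ∇ũ·∇φ̃ dx = ∫_{∂E} φ̃ d(Φ̄_*μ), where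 Φ̄_*μ denotes the pushforward of μ under Φ̄ (a finite signed Borel measure supported on ∂E = Φ̄(∂D)). -/
open MeasureTheory Metric Complex Filter

theorem det_restrictScalars_toSpanSingleton (c : ℂ) :
    ((ContinuousLinearMap.toSpanSingleton ℂ c).restrictScalars ℝ : ℂ →L[ℝ] ℂ).det = ‖c‖ ^ 2 := by
  rw [← Complex.normSq_eq_norm_sq, ← Algebra.norm_complex_apply, Algebra.norm_apply]
  change LinearMap.det _ = _
  congr 1
  ext <;> simp [mul_comm]

/-- The chain rule for the gradient under a locally biholomorphic map; `v` need
not be differentiable. -/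
theorem grad_comp_of_hasDerivAt {f g : ℂ → ℂ} {c z : ℂ} (hf : HasDerivAt f c z)
    (hg : DifferentiableAt ℂ g (f z)) (hgf : g (f z) = z) (hfg : ∀ᶠ w in nhds (f z), f (g w) = w)
    (v : ℂ → ℝ) : grad (v ∘ f) z = grad v (f z) * (starRingEnd ℂ) c := by
  have hf' : HasFDerivAt f
      ((ContinuousLinearMap.toSpanSingleton ℂ c).restrictScalars ℝ : ℂ →L[ℝ] ℂ) z :=
    hf.hasFDerivAt.restrictScalars ℝ
  have hg' : DifferentiableAt ℝ g (f z) := hg.restrictScalars ℝ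
  by_cases hv : DifferentiableAt ℝ v (f z)
  · have key : fderiv ℝ (v ∘ f) z = _ := (hv.hasFDerivAt.comp z hf').fderiv
    have hlin : ∀ w : ℂ, fderiv ℝ v (f z) w
        = w.re * fderiv ℝ v (f z) 1 + w.im * fderiv ℝ v (f z) Complex.I := by
      intro w
      have hw : w = w.re • (1 : ℂ) + w.im • Complex.I := by
        simp [Complex.re_add_im]
      conv_lhs => rw [hw]
      rw [map_add, map_smul, map_smul, smul_eq_mul, smul_eq_mul]
    unfold grad
    rw [key]
    simp only [ContinuousLinearMap.comp_apply, ContinuousLinearMap.coe_restrictScalars',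
      ContinuousLinearMap.toSpanSingleton_apply, smul_eq_mul]
    rw [hlin (1 * c), hlin (Complex.I * c)]
    apply Complex.ext <;> simp <;> ring
  · have hvf : ¬ DifferentiableAt ℝ (v ∘ f) z := by
      intro h
      apply hv
      rw [← hgf] at h
      have h2 : DifferentiableAt ℝ ((v ∘ f) ∘ g) (f z) := h.comp (f z) hg'
      refine h2.congr_of_eventuallyEq ?_
      filter_upwards [hfg] with w hw
      simp [hw]
    simp [grad, fderiv_zero_of_not_differentiableAt hv, fderiv_zero_of_not_differentiableAt hvf]

theorem dot_mul_conj (a b c : ℂ) :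
    dot (a * (starRingEnd ℂ) c) (b * (starRingEnd ℂ) c) = ‖c‖ ^ 2 * dot a b := by
  rw [← Complex.normSq_eq_norm_sq]
  simp [dot, Complex.normSq_apply]
  ring

theorem grad_congr_of_eventuallyEq {v w : ℂ → ℝ} {z : ℂ} (h : v =ᶠ[nhds z] w) :
    grad v z = grad w z := by
  simp [grad, h.fderiv_eq]

theorem sIntegral_congr_of_eqOn {α E : Type*} [MeasurableSpace α] [NormedAddCommGroup E]
    [NormedSpace ℝ E] {μ : SignedMeasure α} {s : Set α} (hs : μ.totalVariation sᶜ = 0)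
    {f g : α → E} (h : Set.EqOn f g s) : sIntegral μ f = sIntegral μ g := by
  rw [SignedMeasure.totalVariation, Measure.add_apply, add_eq_zero] at hs
  unfold sIntegral
  congr 1 <;> apply integral_congr_ae <;> rw [Filter.EventuallyEq, ae_iff]
  · exact measure_mono_null (fun x hx hxs => hx (h hxs)) hs.1
  · exact measure_mono_null (fun x hx hxs => hx (h hxs)) hs.2

/-- Conformal transport of weak solutions of the conductivity equation with measure-valued
Neumann data: let Φ be a holomorphic bijection of the bounded open set D onto E with
nonvanishing derivative, extending to a Lipschitz homeomorphism of the closures (the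
inverse homeomorphism being automatic since cl(D) is compact), with inverse Ψ.  If u is a
weak solution on D with conductivity σ and boundary measure μ (supported on ∂D), tested
against all Lipschitz functions, then ũ = u∘Ψ is differentiable on E with |∇ũ| ∈ L¹(E)
and solves the transported problem with conductivity σ∘Ψ and the pushforward measure
Φ̄_*μ, i.e. ∫_E (σ∘Ψ) ∇ũ·∇φ̃ dx = ∫_{∂D} φ̃∘Φ̄ dμ (= ∫_{∂E} φ̃ d(Φ̄_*μ)) for every
Lipschitz φ̃ : ℝ² → ℝ. -/
theorem stmt10 (D E : Set ℂ)
    (hDopen : IsOpen D) (hDbdd : Bornology.IsBounded D)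
    (hEopen : IsOpen E) (hEbdd : Bornology.IsBounded E)
    (Φ : ℂ → ℂ)
    (hΦdiff : ∀ z ∈ D, DifferentiableAt ℂ Φ z ∧ deriv Φ z ≠ 0)
    (hΦim : Φ '' D = E)
    (hΦinj : Set.InjOn Φ (closure D))
    (hΦcl : Φ '' closure D = closure E)
    (hΦlip : ∃ K : NNReal, LipschitzOnWith K Φ (closure D))
    (Ψ : ℂ → ℂ) (hΨ : ∀ z ∈ closure D, Ψ (Φ z) = z)
    (σ : ℂ → ℝ) (hσm : Measurable σ) (hσb : ∃ M : ℝ, ∀ x ∈ D, |σ x| ≤ M)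
    (μ : SignedMeasure ℂ) (hsupp : μ.totalVariation (frontier D)ᶜ = 0)
    (u : ℂ → ℝ) (hu : ∀ x ∈ D, DifferentiableAt ℝ u x)
    (hu1 : IntegrableOn (fun x => ‖grad u x‖) D volume)
    (hweak : ∀ φ : ℂ → ℝ, (∃ K : NNReal, LipschitzWith K φ) →
      ∫ x in D, σ x * dot (grad u x) (grad φ x) = sIntegral μ φ) :
    (∀ w ∈ E, DifferentiableAt ℝ (u ∘ Ψ) w) ∧
    IntegrableOn (fun w => ‖grad (u ∘ Ψ) w‖) E volume ∧
    ∀ φt : ℂ → ℝ, (∃ K : NNReal, LipschitzWith K φt) →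
      ∫ w in E, σ (Ψ w) * dot (grad (u ∘ Ψ) w) (grad φt w)
        = sIntegral μ (fun x => φt (Φ x)) := by
  have hsub : D ⊆ closure D := subset_closure
  obtain ⟨K, hK⟩ := hΦlip
  have hΦd : ∀ z ∈ D, HasDerivAt Φ (deriv Φ z) z := fun z hz => (hΦdiff z hz).1.hasDerivAt
  have hΨd : ∀ z ∈ D, HasDerivAt Ψ (deriv Φ z)⁻¹ (Φ z) := by
    intro z hz
    have hana : AnalyticAt ℂ Φ z :=
      DifferentiableOn.analyticAt (fun w hw => (hΦdiff w hw).1.differentiableWithinAt)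
        (hDopen.mem_nhds hz)
    refine (hana.hasStrictDerivAt.to_local_left_inverse (hΦdiff z hz).2 ?_).hasDerivAt
    filter_upwards [hDopen.mem_nhds hz] with w hw using hΨ w (hsub hw)
  have hΦΨ : ∀ w ∈ E, Φ (Ψ w) = w := by
    rw [← hΦim]
    rintro _ ⟨z, hz, rfl⟩
    rw [hΨ z (hsub hz)]
  have hgrad : ∀ z ∈ D, ∀ v : ℂ → ℝ,
      grad (v ∘ Φ) z = grad v (Φ z) * (starRingEnd ℂ) (deriv Φ z) := fun z hz v =>
    grad_comp_of_hasDerivAt (hΦd z hz) (hΨd z hz).differentiableAt (hΨ z (hsub hz))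
      (eventually_of_mem (hEopen.mem_nhds (hΦim ▸ Set.mem_image_of_mem Φ hz)) hΦΨ) v
  have hgradu : ∀ z ∈ D,
      grad u z = grad (u ∘ Ψ) (Φ z) * (starRingEnd ℂ) (deriv Φ z) := by
    intro z hz
    rw [← hgrad z hz]
    apply grad_congr_of_eventuallyEq
    filter_upwards [hDopen.mem_nhds hz] with w hw
    simp [hΨ w (hsub hw)]
  have hfd : ∀ z ∈ D, HasFDerivWithinAt Φ
      ((ContinuousLinearMap.toSpanSingleton ℂ (deriv Φ z)).restrictScalars ℝ : ℂ →L[ℝ] ℂ) D z :=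
    fun z hz => ((hΦd z hz).hasFDerivAt.restrictScalars ℝ).hasFDerivWithinAt
  have hinj : Set.InjOn Φ D := hΦinj.mono hsub
  refine ⟨?_, ?_, ?_⟩
  · rw [← hΦim]
    rintro _ ⟨z, hz, rfl⟩
    refine DifferentiableAt.comp (Φ z) ?_ ((hΨd z hz).differentiableAt.restrictScalars ℝ)
    rw [hΨ z (hsub hz)]
    exact hu z hz
  · rw [← hΦim, integrableOn_image_iff_integrableOn_abs_det_fderiv_smul volume
      hDopen.measurableSet hfd hinj]
    have hbdd : IntegrableOn (fun z => ‖deriv Φ z‖ * ‖grad u z‖) D volume := by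
      refine Integrable.bdd_mul (c := K) hu1 (measurable_deriv Φ).norm.aestronglyMeasurable ?_
      filter_upwards [ae_restrict_mem hDopen.measurableSet] with z hz
      rw [norm_norm]
      exact norm_deriv_le_of_lipschitzOn (hDopen.mem_nhds hz) (hK.mono hsub)
    refine hbdd.congr_fun (fun z hz => ?_) hDopen.measurableSet
    simp only [det_restrictScalars_toSpanSingleton]
    rw [hgradu z hz, norm_mul, RCLike.norm_conj, abs_of_nonneg (by positivity), smul_eq_mul]
    ring
  · rintro φt ⟨L, hL⟩
    obtain ⟨φ, hφ, hφeq⟩ := (hL.comp_lipschitzOnWith hK).extend_real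
    rw [sIntegral_congr_of_eqOn hsupp (f := fun x => φt (Φ x)) (g := φ)
      (fun x hx => hφeq (frontier_subset_closure hx)),
      ← hweak φ ⟨_, hφ⟩, ← hΦim, integral_image_eq_integral_abs_det_fderiv_smul volume
      hDopen.measurableSet hfd hinj]
    refine setIntegral_congr_fun hDopen.measurableSet (fun z hz => ?_)
    have hφz : grad φ z = grad (φt ∘ Φ) z := by
      apply grad_congr_of_eventuallyEq
      filter_upwards [hDopen.mem_nhds hz] with w hw using (hφeq (hsub hw)).symm
    simp only [det_restrictScalars_toSpanSingleton]
    rw [hφz, hgrad z hz, hgradu z hz, dot_mul_conj, hΨ z (hsub hz),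
      abs_of_nonneg (by positivity), smul_eq_mul]
    ring
end

section
/- Let 0 < R < 1 and U = {x ∈ ℝ² : |x| < R}. Let μ and μ_j (j ∈ ℕ) be finite signed Borel measures on the unit circle ∂B such that sup_j |μ_j|(∂B) < ∞ and ∫_{∂B} f dμ_j → ∫_{∂B} f dμ for every continuous f : ∂B → ℝ. For a finite signed Borel measure ν on ∂B define (Gν)(x) = −(1/π) ∫_{∂B} (x − y)/|x − y|² dν(y) for x ∈ U. Then Gμ_j → Gμ in L²(U, ℝ²). -/
open MeasureTheory Metric Complex Filter ENNReal

/-- (Gν)(x) = −(1/π) ∫_{∂B} (x−y)/|x−y|² dν(y), the gradient of the background Neumann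
solution with boundary current ν, at x. -/
noncomputable def Gop (ν : SignedMeasure ℂ) (x : ℂ) : ℂ :=
  -(1 / Real.pi) • sIntegral ν (fun y => (‖x - y‖ ^ 2)⁻¹ • (x - y))

theorem ae_posPart_of_ae_totalVariation {α : Type*} [MeasurableSpace α] {ν : SignedMeasure α}
    {p : α → Prop} (h : ∀ᵐ y ∂ν.totalVariation, p y) :
    ∀ᵐ y ∂ν.toJordanDecomposition.posPart, p y :=
  (ae_add_measure_iff.1 h).1

theorem ae_negPart_of_ae_totalVariation {α : Type*} [MeasurableSpace α] {ν : SignedMeasure α}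
    {p : α → Prop} (h : ∀ᵐ y ∂ν.totalVariation, p y) :
    ∀ᵐ y ∂ν.toJordanDecomposition.negPart, p y :=
  (ae_add_measure_iff.1 h).2

instance isFiniteMeasure_totalVariation {α : Type*} [MeasurableSpace α] (ν : SignedMeasure α) :
    IsFiniteMeasure ν.totalVariation := by
  unfold SignedMeasure.totalVariation
  infer_instance

theorem norm_sIntegral_le {α : Type*} [MeasurableSpace α] {E : Type*} [NormedAddCommGroup E]
    [NormedSpace ℝ E] {ν : SignedMeasure α} {f : α → E} {M : ℝ}
    (h : ∀ᵐ y ∂ν.totalVariation, ‖f y‖ ≤ M) :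
    ‖sIntegral ν f‖ ≤ M * ν.totalVariation.real Set.univ := by
  have h₁ := norm_integral_le_of_norm_le_const (ae_posPart_of_ae_totalVariation h)
  have h₂ := norm_integral_le_of_norm_le_const (ae_negPart_of_ae_totalVariation h)
  have h₃ : ν.totalVariation.real Set.univ = ν.toJordanDecomposition.posPart.real Set.univ +
      ν.toJordanDecomposition.negPart.real Set.univ := by
    unfold SignedMeasure.totalVariation
    exact measureReal_add_apply
  rw [h₃, mul_add]
  exact (norm_sub_le _ _).trans (add_le_add h₁ h₂)

theorem sIntegral_clm_comp {α : Type*} [MeasurableSpace α] {E F : Type*}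
    [NormedAddCommGroup E] [NormedSpace ℝ E] [CompleteSpace E]
    [NormedAddCommGroup F] [NormedSpace ℝ F] [CompleteSpace F]
    {ν : SignedMeasure α} {f : α → E} (L : E →L[ℝ] F) (hf : Integrable f ν.totalVariation) :
    sIntegral ν (fun y => L (f y)) = L (sIntegral ν f) := by
  have h := integrable_add_measure.1 hf
  unfold sIntegral
  rw [map_sub, L.integral_comp_comm h.1, L.integral_comp_comm h.2]

theorem measurable_gradient_kernel :
    Measurable fun p : ℂ × ℂ => (‖p.1 - p.2‖ ^ 2)⁻¹ • (p.1 - p.2) := by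
  fun_prop

theorem stronglyMeasurable_Gop (ν : SignedMeasure ℂ) : StronglyMeasurable (Gop ν) := by
  have h : StronglyMeasurable
      (Function.uncurry fun x y : ℂ => (‖x - y‖ ^ 2)⁻¹ • (x - y)) :=
    measurable_gradient_kernel.stronglyMeasurable
  unfold Gop sIntegral
  have h_int (κ : Measure ℂ) [IsFiniteMeasure κ] :
      StronglyMeasurable fun x => ∫ y, (‖x - y‖ ^ 2)⁻¹ • (x - y) ∂κ :=
    h.integral_prod_right
  exact ((h_int ν.toJordanDecomposition.posPart).sub
    (h_int ν.toJordanDecomposition.negPart)).const_smul (-(1 / Real.pi))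

theorem norm_gradient_kernel_le {R : ℝ} (hR1 : R < 1) {x y : ℂ} (hx : x ∈ ball (0 : ℂ) R)
    (hy : y ∈ sphere (0 : ℂ) 1) : ‖(‖x - y‖ ^ 2)⁻¹ • (x - y)‖ ≤ (1 - R)⁻¹ := by
  rw [mem_ball_zero_iff] at hx
  rw [mem_sphere_zero_iff_norm] at hy
  have h : 1 - R ≤ ‖x - y‖ := by
    have := norm_sub_norm_le y x
    rw [norm_sub_rev] at this
    linarith
  have h0 : 0 < ‖x - y‖ := by linarith
  have : ‖(‖x - y‖ ^ 2)⁻¹ • (x - y)‖ = ‖x - y‖⁻¹ := by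
    rw [norm_smul, norm_inv, norm_pow, norm_norm]
    field_simp
  rw [this]
  exact inv_anti₀ (by linarith) h

theorem continuousOn_gradient_kernel {R : ℝ} (hR1 : R < 1) {x : ℂ} (hx : x ∈ ball (0 : ℂ) R) :
    ContinuousOn (fun y => (‖x - y‖ ^ 2)⁻¹ • (x - y)) (sphere (0 : ℂ) 1) := by
  have hdist : Continuous fun y => ‖x - y‖ ^ 2 := by fun_prop
  have hsub : Continuous fun y => x - y := by fun_prop
  refine (hdist.continuousOn.inv₀ fun y hy => ?_).smul hsub.continuousOn
  rw [mem_ball_zero_iff] at hx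
  rw [mem_sphere_zero_iff_norm] at hy
  have : x - y ≠ 0 := by
    intro h
    rw [sub_eq_zero.1 h] at hx
    linarith
  positivity

theorem ae_mem_sphere {ν : SignedMeasure ℂ}
    (h : ν.totalVariation (sphere (0 : ℂ) 1)ᶜ = 0) :
    ∀ᵐ y ∂ν.totalVariation, y ∈ sphere (0 : ℂ) 1 := h

theorem integrable_gradient_kernel {R : ℝ} (hR1 : R < 1) {x : ℂ} (hx : x ∈ ball (0 : ℂ) R)
    {ν : SignedMeasure ℂ} (h : ν.totalVariation (sphere (0 : ℂ) 1)ᶜ = 0) :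
    Integrable (fun y => (‖x - y‖ ^ 2)⁻¹ • (x - y)) ν.totalVariation := by
  refine Integrable.of_bound ?_ (1 - R)⁻¹ ?_
  · exact (measurable_gradient_kernel.comp measurable_prodMk_left).aestronglyMeasurable
  · filter_upwards [ae_mem_sphere h] with y hy
    exact norm_gradient_kernel_le hR1 hx hy

theorem norm_Gop_le {R : ℝ} (hR1 : R < 1) {x : ℂ} (hx : x ∈ ball (0 : ℂ) R)
    {ν : SignedMeasure ℂ} (h : ν.totalVariation (sphere (0 : ℂ) 1)ᶜ = 0) :
    ‖Gop ν x‖ ≤ 1 / Real.pi * ((1 - R)⁻¹ * ν.totalVariation.real Set.univ) := by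
  unfold Gop
  rw [norm_smul, norm_neg, Real.norm_of_nonneg (by positivity)]
  gcongr
  apply norm_sIntegral_le
  filter_upwards [ae_mem_sphere h] with y hy
  exact norm_gradient_kernel_le hR1 hx hy

theorem tendsto_Gop {R : ℝ} (hR1 : R < 1) {μ : SignedMeasure ℂ} {μj : ℕ → SignedMeasure ℂ}
    (hsupp : μ.totalVariation (sphere (0 : ℂ) 1)ᶜ = 0)
    (hsuppj : ∀ j, (μj j).totalVariation (sphere (0 : ℂ) 1)ᶜ = 0)
    (hconv : ∀ f : ℂ → ℝ, ContinuousOn f (sphere (0 : ℂ) 1) →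
      Tendsto (fun j => sIntegral (μj j) f) atTop (nhds (sIntegral μ f)))
    {x : ℂ} (hx : x ∈ ball (0 : ℂ) R) :
    Tendsto (fun j => Gop (μj j) x) atTop (nhds (Gop μ x)) := by
  unfold Gop
  refine Tendsto.const_smul ?_ _
  have key (L : ℂ →L[ℝ] ℝ) := hconv (fun y => L ((‖x - y‖ ^ 2)⁻¹ • (x - y)))
    (L.continuous.comp_continuousOn (continuousOn_gradient_kernel hR1 hx))
  simp only [sIntegral_clm_comp _ (integrable_gradient_kernel hR1 hx hsupp),
    sIntegral_clm_comp _ (integrable_gradient_kernel hR1 hx (hsuppj _))] at key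
  have hre := key reCLM
  have him := key imCLM
  simpa only [Function.comp_def, reCLM_apply, imCLM_apply, Complex.re_add_im] using
    ((Complex.continuous_ofReal.tendsto _).comp hre).add
      (((Complex.continuous_ofReal.tendsto _).comp him).mul_const I)

/-- Weak*-to-L² continuity of G: let 0 < R < 1, U = {|x| < R}, and let μ, μ_j be finite
signed Borel measures on the unit circle with uniformly bounded total variations such that
∫ f dμ_j → ∫ f dμ for every continuous f.  Then Gμ_j → Gμ in L²(U, ℝ²). -/
theorem stmt12 (R : ℝ) (hR0 : 0 < R) (hR1 : R < 1)
    (μ : SignedMeasure ℂ) (μj : ℕ → SignedMeasure ℂ)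
    (hsupp : μ.totalVariation (Metric.sphere (0:ℂ) 1)ᶜ = 0)
    (hsuppj : ∀ j, (μj j).totalVariation (Metric.sphere (0:ℂ) 1)ᶜ = 0)
    (hbdd : ∃ C : ℝ≥0∞, C < ⊤ ∧ ∀ j, (μj j).totalVariation Set.univ ≤ C)
    (hconv : ∀ f : ℂ → ℝ, ContinuousOn f (Metric.sphere (0:ℂ) 1) →
      Tendsto (fun j => sIntegral (μj j) f) atTop (nhds (sIntegral μ f))) :
    Tendsto (fun j => eLpNorm (fun x => Gop (μj j) x - Gop μ x) 2
      (volume.restrict (Metric.ball (0:ℂ) R))) atTop (nhds 0) := by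
  obtain ⟨C, hC, hle⟩ := hbdd
  have hreal (j : ℕ) : (μj j).totalVariation.real Set.univ ≤ C.toReal :=
    ENNReal.toReal_mono hC.ne (hle j)
  set D : ℝ := 1 / Real.pi * ((1 - R)⁻¹ * C.toReal) +
    1 / Real.pi * ((1 - R)⁻¹ * μ.totalVariation.real Set.univ) with hD
  have h1R : 0 < 1 - R := by linarith
  have hbound (j : ℕ) {x : ℂ} (hx : x ∈ ball (0 : ℂ) R) : ‖Gop (μj j) x - Gop μ x‖ ≤ D := by
    refine (norm_sub_le _ _).trans (add_le_add ((norm_Gop_le hR1 hx (hsuppj j)).trans ?_)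
      (norm_Gop_le hR1 hx hsupp))
    gcongr
    exact hreal j
  have hlint : Tendsto (fun j => ∫⁻ x in ball (0 : ℂ) R, ‖Gop (μj j) x - Gop μ x‖ₑ ^ (2 : ℝ))
      atTop (nhds (∫⁻ _ in ball (0 : ℂ) R, 0)) := by
    refine tendsto_lintegral_of_dominated_convergence (fun _ => ENNReal.ofReal D ^ (2 : ℝ))
      (fun j => ?_) (fun j => ?_) ?_ ?_
    · exact ((stronglyMeasurable_Gop _).sub (stronglyMeasurable_Gop _)).measurable.enorm.pow_const _
    · filter_upwards [ae_restrict_mem measurableSet_ball] with x hx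
      gcongr
      rw [← ofReal_norm]
      exact ENNReal.ofReal_le_ofReal (hbound j hx)
    · rw [lintegral_const, Measure.restrict_apply_univ]
      exact ENNReal.mul_ne_top (by finiteness) measure_ball_lt_top.ne
    · filter_upwards [ae_restrict_mem measurableSet_ball] with x hx
      have h := (tendsto_Gop hR1 hsupp hsuppj hconv hx).sub_const (Gop μ x)
      rw [sub_self] at h
      simpa using h.enorm.ennrpow_const 2
  simp only [eLpNorm_eq_lintegral_rpow_enorm_toReal two_ne_zero ofNat_ne_top, toReal_ofNat]
  simpa using hlint.ennrpow_const (1 / 2)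
end
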